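/- Let I ⊆ Π be μ-connected. Then F_I ∩ C̄ is the union, over all μ-connected subsets K ⊆ I, of the sets ri(F_K) ∩ C̄, and also the union, over all μ-connected subsets K ⊆ I, of the sets (μ − ℝ_>K) ∩ C̄; in both cases the sets in the union are pairwise disjoint, and ri(F_K) ∩ C̄ = (μ − ℝ_>K) ∩ C̄ for each such K. -/

import Mathlib

open Set Module

noncomputable section

/-- The linear reflection `x ↦ x - f x • a` associated to a vector `a` and a linear
functional `f` with `f a = 2`, bundled as a linear automorphism. -/
def reflEquiv {V : Type*} [AddCommGroup V] [Module ℝ V]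
    (a : V) (f : V →ₗ[ℝ] ℝ) (h2 : f a = 2) : V ≃ₗ[ℝ] V :=
  LinearEquiv.ofInvolutive (LinearMap.id - f.smulRight a)
    (fun x => by
      simp only [LinearMap.sub_apply, LinearMap.id_apply, LinearMap.smulRight_apply,
        map_sub, map_smul, smul_eq_mul, h2]
      module)

/-- A realization over `ℝ` of an `m × m` generalized Cartan matrix `A`:
simple roots `α_i`, simple coroots `α_i∨` (as linear functionals), with
`⟨α_j, α_i∨⟩ = a_{ij}`, together with the defining axioms. -/
structure GCMRealization (m : ℕ) (V : Type*) [NormedAddCommGroup V] [NormedSpace ℝ V] where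
  A : Matrix (Fin m) (Fin m) ℤ
  root : Fin m → V
  coroot : Fin m → V →ₗ[ℝ] ℝ
  one_le_m : 1 ≤ m
  A_diag : ∀ i, A i i = 2
  A_offdiag : ∀ i j, i ≠ j → A i j ≤ 0
  A_zero_iff : ∀ i j, A i j = 0 ↔ A j i = 0
  root_indep : LinearIndependent ℝ root
  coroot_indep : LinearIndependent ℝ coroot
  pairing : ∀ i j, coroot i (root j) = (A i j : ℝ)
  finDim : FiniteDimensional ℝ V
  dim_eq : finrank ℝ V + (A.map ((↑) : ℤ → ℝ)).rank = 2 * m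

/-- A face of a convex set `H`: a convex subset `F ⊆ H` such that whenever the open
segment between two points of `H` meets `F`, both points lie in `F`. -/
def IsFaceOf {V : Type*} [NormedAddCommGroup V] [NormedSpace ℝ V] (H F : Set V) : Prop :=
  Convex ℝ F ∧ IsExtreme ℝ H F

namespace GCMRealization

variable {m : ℕ} {V : Type*} [NormedAddCommGroup V] [NormedSpace ℝ V]
variable (S : GCMRealization m V)

/-- The fundamental reflection `r_i`. -/
def s (i : Fin m) : V ≃ₗ[ℝ] V :=
  reflEquiv (S.root i) (S.coroot i) (by
    have h := S.pairing i i
    rw [S.A_diag i] at h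
    simpa using h)

/-- The Weyl group `W`, as a subgroup of the group of linear automorphisms of `V`. -/
def W : Subgroup (V ≃ₗ[ℝ] V) := Subgroup.closure (Set.range S.s)

/-- The standard parabolic subgroup `W_I` generated by the reflections indexed by `I`. -/
def WI (I : Set (Fin m)) : Subgroup (V ≃ₗ[ℝ] V) := Subgroup.closure (S.s '' I)

/-- The closed fundamental chamber `C̄`. -/
def chamber : Set V := {η | ∀ i, 0 ≤ S.coroot i η}

/-- `J₀`: the set of indices `i` with `⟨μ, α_i∨⟩ = 0`. -/
def J0 (μ : V) : Set (Fin m) := {i | S.coroot i μ = 0}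

/-- The orbit of `μ` under a subgroup of linear automorphisms. -/
def orbitOf (G : Subgroup (V ≃ₗ[ℝ] V)) (μ : V) : Set V :=
  (fun w : V ≃ₗ[ℝ] V => w μ) '' (G : Set (V ≃ₗ[ℝ] V))

/-- `F_I`: the convex hull of `W_I · μ`. -/
def face (μ : V) (I : Set (Fin m)) : Set V := convexHull ℝ (orbitOf (S.WI I) μ)

/-- `H`: the convex hull of the Weyl group orbit of `μ`. -/
def orbitHull (μ : V) : Set V := convexHull ℝ (orbitOf S.W μ)

/-- `ℝ₊I`: the set of nonnegative linear combinations of the simple roots indexed by `I`. -/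
def coneNonneg (I : Set (Fin m)) : Set V :=
  {v | ∃ c : Fin m → ℝ, (∀ i, 0 ≤ c i) ∧ (∀ i, i ∉ I → c i = 0) ∧ v = ∑ i, c i • S.root i}

/-- `ℝ_>I`: the set of strictly positive linear combinations of the simple roots indexed
by `I` (with `ℝ_>∅ = {0}`). -/
def conePos (I : Set (Fin m)) : Set V :=
  {v | ∃ c : Fin m → ℝ, (∀ i ∈ I, 0 < c i) ∧ (∀ i, i ∉ I → c i = 0) ∧ v = ∑ i, c i • S.root i}

/-- The open standard facet `C_J`. -/
def openFacet (J : Set (Fin m)) : Set V :=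
  {η | (∀ i ∈ J, S.coroot i η = 0) ∧ ∀ i, i ∉ J → 0 < S.coroot i η}

/-- The closed standard facet `C̄_J`. -/
def closedFacet (J : Set (Fin m)) : Set V :=
  {η | (∀ i ∈ J, S.coroot i η = 0) ∧ ∀ i, i ∉ J → 0 ≤ S.coroot i η}

/-- Adjacency of two vertices of the Dynkin diagram: `i ≠ j` and `a_{ij} ≠ 0`
(equivalently `a_{ji} ≠ 0`). -/
def Adjacent (i j : Fin m) : Prop := i ≠ j ∧ S.A i j ≠ 0 ∧ S.A j i ≠ 0

/-- The Dynkin diagram, as a simple graph on the index set. -/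
def diagram : SimpleGraph (Fin m) where
  Adj := S.Adjacent
  symm := ⟨fun _ _ h => ⟨h.1.symm, h.2.2, h.2.1⟩⟩
  loopless := ⟨fun _ h => h.1 rfl⟩

/-- A subset `I` is `μ`-connected if every connected component of `I` meets
`J_> = Π \ J₀` (the empty set is `μ`-connected). -/
def MuConnected (μ : V) (I : Set (Fin m)) : Prop :=
  ∀ i : I, ∃ j : I, S.coroot (j : Fin m) μ ≠ 0 ∧ (S.diagram.induce I).Reachable i j

/-- The connected component of `i` inside `K`, as a subset of the index set. -/
def comp (K : Set (Fin m)) (i : Fin m) : Set (Fin m) :=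
  {j | ∃ (hi : i ∈ K) (hj : j ∈ K), (S.diagram.induce K).Reachable ⟨i, hi⟩ ⟨j, hj⟩}

/-- `I*`: the largest `μ`-connected subset of `I`, i.e. the union of the connected
components of `I` that meet `J_>`. -/
def muPart (μ : V) (I : Set (Fin m)) : Set (Fin m) :=
  {j | ∃ (hj : j ∈ I) (k : Fin m) (hk : k ∈ I), S.coroot k μ ≠ 0 ∧
    (S.diagram.induce I).Reachable ⟨j, hj⟩ ⟨k, hk⟩}

/-- `I_*`: the set of `α ∈ J₀ \ I` orthogonal to all of `I`. -/
def starSet (μ : V) (I : Set (Fin m)) : Set (Fin m) :=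
  {i | S.coroot i μ = 0 ∧ i ∉ I ∧ ∀ j ∈ I, S.coroot i (S.root j) = 0}

/-- A subset `K ⊆ Π` is of finite type if the subgroup `W_K` is finite. -/
def FiniteType (K : Set (Fin m)) : Prop := ((S.WI K : Subgroup (V ≃ₗ[ℝ] V)) : Set (V ≃ₗ[ℝ] V)).Finite

/-- Every connected component of `K` is of finite type. -/
def FinTypeComponents (K : Set (Fin m)) : Prop := ∀ i ∈ K, S.FiniteType (S.comp K i)

/-- A fundamental face of `H`: a face which is empty or whose relative interior meets
the fundamental chamber. -/
def IsFundFace (μ : V) (F : Set V) : Prop :=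
  IsFaceOf (S.orbitHull μ) F ∧ (F = ∅ ∨ (intrinsicInterior ℝ F ∩ S.chamber).Nonempty)

/-- The length of `w ∈ W` with respect to the fundamental reflections. -/
def len (w : V ≃ₗ[ℝ] V) : ℕ :=
  sInf {k | ∃ l : List (Fin m), l.length = k ∧ w = (l.map S.s).prod}

end GCMRealization

end

set_option linter.unusedSectionVars false
noncomputable section
namespace Aux8

section abstractPart
variable {ι : Type*} [Fintype ι] [DecidableEq ι]

/-- The pairing of `μ - γ` with the `i`-th coroot, in coordinates. -/
def PP (B : ι → ι → ℝ) (p : ι → ℝ) (γ : ι → ℝ) (i : ι) : ℝ := p i - ∑ j, B i j * γ j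

/-- Generalized Cartan type conditions used in the convexity part. -/
structure Good (B : ι → ι → ℝ) (p : ι → ℝ) : Prop where
  diag : ∀ i, B i i = 2
  off : ∀ i j, i ≠ j → B i j ≤ 0
  pos : ∀ i, 0 ≤ p i
  conn : ∀ Z : Set ι, Z.Nonempty → ∃ i ∈ Z, p i ≠ 0 ∨ ∃ j, j ∉ Z ∧ B i j ≠ 0

/-- Convex sets stable under all the affine reflections. -/
structure Stab (B : ι → ι → ℝ) (p : ι → ℝ) (D : Set (ι → ℝ)) : Prop where
  cvx : Convex ℝ D
  zero : (0 : ι → ℝ) ∈ D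
  refl : ∀ i, ∀ γ ∈ D, γ + PP B p γ i • Pi.single i 1 ∈ D

variable {B : ι → ι → ℝ} {p : ι → ℝ} {D : Set (ι → ℝ)}

lemma PP_continuous (i : ι) : Continuous fun γ => PP B p γ i := by
  unfold PP; fun_prop

lemma Stab.closure (h : Stab B p D) : Stab B p (closure D) where
  cvx := h.cvx.closure
  zero := subset_closure h.zero
  refl := by
    intro i
    have hc : Continuous fun γ : ι → ℝ => γ + PP B p γ i • (Pi.single i 1 : ι → ℝ) := by
      have := PP_continuous (B := B) (p := p) i
      fun_prop
    intro γ hγ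
    exact map_mem_closure (f := fun γ : ι → ℝ => γ + PP B p γ i • (Pi.single i 1 : ι → ℝ)) hc hγ (h.refl i)

lemma Stab.step (h : Stab B p D) {γ : ι → ℝ} (hγ : γ ∈ D) (i : ι) {t : ℝ} (ht : 0 ≤ t)
    (ht1 : t ≤ PP B p γ i) : γ + t • Pi.single i 1 ∈ D := by
  rcases eq_or_lt_of_le ht with h0 | h0
  · rw [← h0]; simpa using hγ
  have hP : 0 < PP B p γ i := lt_of_lt_of_le h0 ht1
  have := h.cvx.add_smul_mem hγ (h.refl i γ hγ) (t := t / PP B p γ i)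
    ⟨by positivity, (div_le_one hP).2 ht1⟩
  rw [smul_smul, div_mul_cancel₀ _ hP.ne'] at this
  exact this

lemma PP_add (γ : ι → ℝ) (t : ℝ) (j i : ι) :
    PP B p (γ + t • Pi.single j 1) i = PP B p γ i - t * B i j := by
  simp only [PP, Pi.add_apply, Pi.smul_apply, smul_eq_mul, mul_add, Finset.sum_add_distrib]
  have : ∑ k, B i k * (t * (Pi.single j 1 : ι → ℝ) k) = t * B i j := by
    rw [Finset.sum_eq_single j]
    · simp; ring
    · intro b _ hb; simp [Pi.single_eq_of_ne hb]
    · simp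
  rw [this]; ring

/-- Positivity lemma. -/
lemma Good.pos_of (hg : Good B p) {x : ι → ℝ} (hx : ∀ i, 0 ≤ x i) {τ : ℝ} (hτ : 0 < τ)
    (h : ∀ i, x i = 0 → τ * p i ≤ ∑ j, B i j * x j) : ∀ i, 0 < x i := by
  by_contra! hcon
  obtain ⟨i0, hi0⟩ := hcon
  obtain ⟨i, hi, hh⟩ := hg.conn {i | x i = 0} ⟨i0, le_antisymm hi0 (hx i0)⟩
  have hi' : x i = 0 := hi
  have hterm : ∀ j ∈ Finset.univ, B i j * x j ≤ 0 := by
    intro j _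
    by_cases hij : i = j
    · subst hij; rw [hi']; simp
    · exact mul_nonpos_of_nonpos_of_nonneg (hg.off i j hij) (hx j)
  have h1 := h i hi'
  have h2 := Finset.sum_nonpos hterm
  have h3 : 0 ≤ τ * p i := mul_nonneg hτ.le (hg.pos i)
  rcases hh with hp | ⟨j, hj, hB⟩
  · have : 0 < p i := lt_of_le_of_ne (hg.pos i) (Ne.symm hp)
    have : 0 < τ * p i := by positivity
    linarith
  · have h4 : ∑ j, B i j * x j = 0 := by linarith
    have h5 := (Finset.sum_eq_zero_iff_of_nonpos hterm).1 h4 j (Finset.mem_univ _)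
    rcases mul_eq_zero.1 h5 with h6 | h6
    · exact hB h6
    · exact hj h6

/-- Claim 1: dominant points below `μ` are in the closed hull. -/
lemma Good.mem_closure (hg : Good B p) (hD : Stab B p D) {c : ι → ℝ} (hc : ∀ i, 0 < c i)
    (hP : ∀ i, 0 ≤ PP B p c i) : c ∈ closure D := by
  have hC := hD.closure
  have hcomp : IsCompact (closure D ∩ Icc 0 c) := isCompact_Icc.inter_left isClosed_closure
  have hne : (closure D ∩ Icc 0 c).Nonempty :=
    ⟨0, hC.zero, le_refl _, fun i => (hc i).le⟩
  obtain ⟨γ, ⟨hγD, hγ0, hγc⟩, hmax⟩ := hcomp.exists_isMaxOn hne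
    (f := fun γ : ι → ℝ => ∑ i, γ i) (by fun_prop)
  by_cases hγ : γ = c
  · rwa [← hγ]
  exfalso
  have hN : ∀ i, γ i < c i → PP B p γ i ≤ 0 := by
    intro i hi
    by_contra! hpos
    set t := min (PP B p γ i) (c i - γ i) with ht
    have ht0 : 0 < t := lt_min hpos (by linarith)
    have hmem := hC.step hγD i ht0.le (min_le_left _ _)
    have h2 : γ + t • Pi.single i 1 ∈ Icc 0 c := by
      constructor
      · intro j
        have h1 : 0 ≤ γ j := hγ0 j
        have h2 : (0:ℝ) ≤ (Pi.single i 1 : ι → ℝ) j := by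
          by_cases hj : j = i
          · subst hj; simp
          · simp [Pi.single_eq_of_ne hj]
        simp only [Pi.zero_apply, Pi.add_apply, Pi.smul_apply, smul_eq_mul]
        positivity
      · intro j
        by_cases hj : j = i
        · subst hj
          have : t ≤ c j - γ j := min_le_right _ _
          simp; linarith
        · simpa [Pi.single_eq_of_ne hj] using hγc j
    have h3 := hmax ⟨hmem, h2⟩
    simp only [Set.mem_ofPred_eq, Pi.add_apply, Finset.sum_add_distrib, Pi.smul_apply,
      smul_eq_mul, ← Finset.mul_sum] at h3
    have h5 : ∑ j, (Pi.single i (1:ℝ) : ι → ℝ) j = 1 := by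
      simp
    rw [h5] at h3
    linarith
  have hγpos : ∀ i, 0 < γ i := by
    refine hg.pos_of (fun i => hγ0 i) one_pos ?_
    intro i hi
    have := hN i (by rw [hi]; exact hc i)
    unfold PP at this
    linarith
  obtain ⟨i0, hi0⟩ : ∃ i, γ i < c i := by
    by_contra! hh
    exact hγ (le_antisymm hγc hh)
  obtain ⟨i1, -, hi1⟩ := Finset.exists_max_image Finset.univ (fun i => (c i - γ i) / γ i)
    ⟨i0, Finset.mem_univ _⟩
  set t := (c i1 - γ i1) / γ i1 with ht
  have ht0 : 0 < t := by
    have h1 := hi1 i0 (Finset.mem_univ _)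
    have : 0 < (c i0 - γ i0) / γ i0 := div_pos (by linarith) (hγpos i0)
    linarith
  have hlt : ∀ i, 0 < (fun i => t * γ i - (c i - γ i)) i := by
    refine hg.pos_of ?_ ht0 ?_
    · intro i
      have := hi1 i (Finset.mem_univ _)
      rw [div_le_iff₀ (hγpos i)] at this
      linarith
    · intro i hi
      have h1 : γ i < c i := by
        have := mul_pos ht0 (hγpos i)
        linarith
      have h2 := hN i h1
      have h3 := hP i
      have h4 : ∑ j, B i j * (t * γ j - (c j - γ j))
          = t * (p i - PP B p γ i) - (PP B p γ i - PP B p c i) := by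
        simp only [PP, mul_sub, Finset.sum_sub_distrib]
        have : ∑ j, B i j * (t * γ j) = t * ∑ j, B i j * γ j := by
          rw [Finset.mul_sum]; exact Finset.sum_congr rfl fun j _ => by ring
        rw [this]; ring
      rw [h4]
      have h5 : t * PP B p γ i ≤ 0 := mul_nonpos_of_nonneg_of_nonpos ht0.le h2
      linarith
  have := hlt i1
  simp only [ht, div_mul_cancel₀ _ (hγpos i1).ne'] at this
  linarith

/-- Existence of a point of `D` in the open chamber. -/
lemma Good.exists_regular (hg : Good B p) (hD : Stab B p D) :
    ∃ ζ ∈ D, ∀ i, 0 < PP B p ζ i := by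
  classical
  have key : ∀ n : ℕ, ∀ γ ∈ D, (∀ i, 0 ≤ PP B p γ i) → (∀ i, p i ≠ 0 → 0 < PP B p γ i) →
      (Finset.univ.filter fun i => PP B p γ i = 0).card = n →
      ∃ ζ ∈ D, ∀ i, 0 < PP B p ζ i := by
    intro n
    induction n using Nat.strong_induction_on with
    | _ n ih =>
      intro γ hγ h0 hp hn
      by_cases hZ : {i | PP B p γ i = 0}.Nonempty
      · obtain ⟨i, hi, hh⟩ := hg.conn _ hZ
        have hi' : PP B p γ i = 0 := hi
        rcases hh with hh | ⟨j, hj, hB⟩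
        · exact absurd hi' (hp i hh).ne'
        have hjp : 0 < PP B p γ j := lt_of_le_of_ne (h0 j) (Ne.symm hj)
        have hij : i ≠ j := by rintro rfl; exact hj hi
        have hB' : B i j < 0 := lt_of_le_of_ne (hg.off i j hij) hB
        set δ := PP B p γ j / 4 with hδ
        have hδ0 : 0 < δ := by positivity
        have hge : ∀ k, 0 < PP B p γ k → 0 < PP B p (γ + δ • Pi.single j 1) k := by
          intro k hk
          rw [PP_add]
          by_cases hkj : k = j
          · subst hkj; rw [hg.diag]; linarith
          · have := mul_nonpos_of_nonneg_of_nonpos hδ0.le (hg.off k j hkj)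
            linarith
        refine ih _ ?_ (γ + δ • Pi.single j 1) (hD.step hγ j hδ0.le (by linarith)) ?_ ?_ rfl
        · rw [← hn]
          apply Finset.card_lt_card
          rw [Finset.ssubset_iff_of_subset]
          · refine ⟨i, by simpa using hi', ?_⟩
            simp only [Finset.mem_filter, Finset.mem_univ, true_and, PP_add, hi']
            have := mul_neg_of_pos_of_neg hδ0 hB'
            linarith
          · intro k hk
            simp only [Finset.mem_filter, Finset.mem_univ, true_and] at hk ⊢
            by_contra hne
            exact (hge k (lt_of_le_of_ne (h0 k) (Ne.symm hne))).ne' hk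
        · intro k
          rcases eq_or_lt_of_le (h0 k) with hk | hk
          · have hkj : k ≠ j := by rintro rfl; linarith
            rw [PP_add, ← hk]
            have := mul_nonpos_of_nonneg_of_nonpos hδ0.le (hg.off k j hkj)
            linarith
          · exact (hge k hk).le
        · exact fun k hk => hge k (hp k hk)
      · refine ⟨γ, hγ, fun i => lt_of_le_of_ne (h0 i) fun h => hZ ⟨i, h.symm⟩⟩
  have hz : ∀ i, PP B p 0 i = p i := by simp [PP]
  refine key _ 0 hD.zero ?_ ?_ rfl
  · intro i; rw [hz]; exact hg.pos i
  · intro i hi; rw [hz]; exact lt_of_le_of_ne (hg.pos i) (Ne.symm hi)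

lemma Good.interior_nonempty (hg : Good B p) (hD : Stab B p D) : (interior D).Nonempty := by
  rw [hD.cvx.interior_nonempty_iff_affineSpan_eq_top]
  obtain ⟨ζ, hζ, hpos⟩ := hg.exists_regular hD
  rw [AffineSubspace.affineSpan_eq_top_iff_vectorSpan_eq_top_of_nonempty ℝ _ _ ⟨ζ, hζ⟩]
  rw [eq_top_iff, ← (Pi.basisFun ℝ ι).span_eq, Submodule.span_le]
  rintro _ ⟨i, rfl⟩
  have h1 := vsub_mem_vectorSpan ℝ (hD.refl i ζ hζ) hζ
  simp only [vsub_eq_sub, add_sub_cancel_left] at h1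
  have h2 := (vectorSpan ℝ D).smul_mem (PP B p ζ i)⁻¹ h1
  rw [smul_smul, inv_mul_cancel₀ (hpos i).ne', one_smul] at h2
  simpa using h2

/-- The dual linear reflection. -/
def TT (B : ι → ι → ℝ) (i : ι) : (ι → ℝ) →ₗ[ℝ] (ι → ℝ) :=
  LinearMap.id - (LinearMap.proj i : (ι → ℝ) →ₗ[ℝ] ℝ).smulRight (B i)

lemma TT_apply (i : ι) (g : ι → ℝ) : TT B i g = g - g i • B i := by simp [TT]

lemma TT_invol (hg : Good B p) (i : ι) (g : ι → ℝ) : TT B i (TT B i g) = g := by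
  simp only [TT_apply, Pi.sub_apply, Pi.smul_apply, smul_eq_mul, hg.diag]
  ext j
  simp
  ring

lemma TT_dot (i : ι) (g x : ι → ℝ) :
    TT B i g ⬝ᵥ x = g ⬝ᵥ (x + PP B p x i • Pi.single i 1) - g i * p i := by
  simp only [TT_apply, sub_dotProduct, smul_dotProduct, dotProduct_add, dotProduct_smul,
    dotProduct_single, PP, smul_eq_mul]
  simp only [dotProduct]
  ring

/-- The cone of functionals attaining their maximum at `c`. -/
def QQ (D : Set (ι → ℝ)) (c : ι → ℝ) : Set (ι → ℝ) := {g | ∀ x ∈ D, g ⬝ᵥ x ≤ g ⬝ᵥ c}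

lemma QQ_add {c g h : ι → ℝ} (h1 : g ∈ QQ D c) (h2 : h ∈ QQ D c) : g + h ∈ QQ D c := by
  intro x hx
  have := h1 x hx
  have := h2 x hx
  simp only [add_dotProduct]
  linarith

lemma QQ_zero {c : ι → ℝ} : (0 : ι → ℝ) ∈ QQ D c := by
  intro x hx
  simp

lemma QQ_isClosed {c : ι → ℝ} : IsClosed (QQ D c) := by
  have : QQ D c = ⋂ x ∈ D, {g : ι → ℝ | g ⬝ᵥ x ≤ g ⬝ᵥ c} := by
    ext g; simp [QQ]
  rw [this]
  refine isClosed_biInter fun x _ => isClosed_le ?_ ?_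
  · simp only [dotProduct]; fun_prop
  · simp only [dotProduct]; fun_prop

lemma QQ_refl (hD : Stab B p D) {c : ι → ℝ} {i : ι} (hi : PP B p c i = 0) {g : ι → ℝ}
    (h : g ∈ QQ D c) : TT B i g ∈ QQ D c := by
  intro x hx
  rw [TT_dot (p := p), TT_dot (p := p), hi]
  have := h _ (hD.refl i x hx)
  simpa using this

lemma QQ_nonpos (hD : Stab B p D) {c : ι → ℝ} (hcD : c ∈ D) {i : ι} (hi : 0 < PP B p c i)
    {g : ι → ℝ} (h : g ∈ QQ D c) : g i ≤ 0 := by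
  have := h _ (hD.refl i c hcD)
  simp only [dotProduct_add, dotProduct_smul, dotProduct_single, smul_eq_mul] at this
  by_contra! hh
  have := mul_pos hi hh
  linarith

lemma QQ_eq_zero_of_nonpos (hD : Stab B p D) {c : ι → ℝ} (hc : ∀ i, 0 < c i) {g : ι → ℝ}
    (h : g ∈ QQ D c) (hn : ∀ i, g i ≤ 0) : g = 0 := by
  have h0 := h 0 hD.zero
  rw [dotProduct_zero] at h0
  simp only [dotProduct] at h0
  have hterm : ∀ i ∈ Finset.univ, g i * c i ≤ 0 := fun i _ =>
    mul_nonpos_of_nonpos_of_nonneg (hn i) (hc i).le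
  have h1 := le_antisymm (Finset.sum_nonpos hterm) h0
  ext i
  have := (Finset.sum_eq_zero_iff_of_nonpos hterm).1 h1 i (Finset.mem_univ _)
  rcases mul_eq_zero.1 this with h | h
  · exact h
  · exact absurd h (hc i).ne'

lemma QQ_bound (hD : Stab B p D) {c ζ : ι → ℝ} (hc : ∀ i, 0 < c i) (hcD : c ∈ D)
    (hP : ∀ i, 0 ≤ PP B p c i) (hζ : ζ ∈ D) (hζP : ∀ i, 0 < PP B p ζ i) :
    ∃ C : ℝ, 0 ≤ C ∧ ∀ g ∈ QQ D c, ∀ i, |g i| ≤ C * (g ⬝ᵥ c - g ⬝ᵥ ζ) := by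
  set C1 := ∑ i, (PP B p ζ i)⁻¹ with hC1
  have hC1' : ∀ i, (PP B p ζ i)⁻¹ ≤ C1 := fun i =>
    Finset.single_le_sum (f := fun i => (PP B p ζ i)⁻¹)
      (fun j _ => inv_nonneg.2 (hζP j).le) (Finset.mem_univ i)
  have hC10 : 0 ≤ C1 := Finset.sum_nonneg fun j _ => inv_nonneg.2 (hζP j).le
  set C2 := ∑ i, c i with hC2
  have hC20 : 0 ≤ C2 := Finset.sum_nonneg fun j _ => (hc j).le
  set C3 := ∑ i, (c i)⁻¹ with hC3
  have hC30 : 0 ≤ C3 := Finset.sum_nonneg fun j _ => inv_nonneg.2 (hc j).le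
  have hC3' : ∀ i, (c i)⁻¹ ≤ C3 := fun i =>
    Finset.single_le_sum (f := fun i => (c i)⁻¹)
      (fun j _ => inv_nonneg.2 (hc j).le) (Finset.mem_univ i)
  refine ⟨C1 * (1 + C2 * C3), by positivity, ?_⟩
  intro g hg i
  set N := g ⬝ᵥ c - g ⬝ᵥ ζ with hN
  have hN0 : 0 ≤ N := by have := hg ζ hζ; linarith
  have hup : ∀ j, g j ≤ C1 * N := by
    intro j
    rcases eq_or_lt_of_le (hP j) with h | h
    · have := hg _ (hD.refl j ζ hζ)
      simp only [dotProduct_add, dotProduct_smul, dotProduct_single, smul_eq_mul] at this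
      have h1 : PP B p ζ j * g j ≤ N := by rw [hN]; linarith
      have h2 : g j ≤ (PP B p ζ j)⁻¹ * N := by
        rw [← div_eq_inv_mul, le_div_iff₀ (hζP j)]; linarith
      exact h2.trans (mul_le_mul_of_nonneg_right (hC1' j) hN0)
    · exact (QQ_nonpos hD hcD h hg).trans (by positivity)
  have h0 := hg 0 hD.zero
  rw [dotProduct_zero] at h0
  simp only [dotProduct] at h0
  have hlow : -(C1 * N * C2) ≤ g i * c i := by
    rw [← Finset.add_sum_erase _ _ (Finset.mem_univ i)] at h0
    have h1 : ∑ j ∈ Finset.univ.erase i, g j * c j ≤ ∑ j ∈ Finset.univ.erase i, C1 * N * c j :=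
      Finset.sum_le_sum fun j _ => mul_le_mul_of_nonneg_right (hup j) (hc j).le
    have h2 : ∑ j ∈ Finset.univ.erase i, C1 * N * c j ≤ ∑ j, C1 * N * c j :=
      Finset.sum_le_sum_of_subset_of_nonneg (Finset.erase_subset _ _)
        fun j _ _ => mul_nonneg (by positivity) (hc j).le
    have h3 : ∑ j, C1 * N * c j = C1 * N * C2 := by rw [hC2, Finset.mul_sum]
    linarith
  have hlow2 : -(C1 * N * C2) * (c i)⁻¹ ≤ g i := by
    rw [← div_eq_mul_inv, div_le_iff₀ (hc i)]; exact hlow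
  have h3 : C1 * N * C2 * (c i)⁻¹ ≤ C1 * N * C2 * C3 :=
    mul_le_mul_of_nonneg_left (hC3' i) (by positivity)
  rw [abs_le]
  constructor
  · have : 0 ≤ C1 * N := by positivity
    nlinarith
  · have h4 : 0 ≤ C1 * N * C2 * C3 := by positivity
    have := hup i
    nlinarith

/-- The cone of supporting functionals at a dominant point is trivial. -/
lemma Good.QQ_trivial (hg : Good B p) (hD : Stab B p D) {c : ι → ℝ} (hc : ∀ i, 0 < c i)
    (hcD : c ∈ D) (hP : ∀ i, 0 ≤ PP B p c i) : ∀ g ∈ QQ D c, g = 0 := by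
  classical
  obtain ⟨ζ, hζ, hζP⟩ := hg.exists_regular hD
  obtain ⟨C, hC0, hC⟩ := QQ_bound hD hc hcD hP hζ hζP
  obtain ⟨b, hbQ, hspan, hli⟩ := exists_linearIndependent ℝ (QQ D c)
  have hbfin : Finite b := hli.setFinite
  have : Fintype b := Fintype.ofFinite b
  set U : Submodule ℝ (ι → ℝ) := Submodule.span ℝ (Set.range ((↑) : b → (ι → ℝ))) with hU
  have hUQ : U = Submodule.span ℝ (QQ D c) := by rw [hU, Subtype.range_coe, hspan]
  let e : Basis b ℝ U := Basis.span hli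
  have he : ∀ j, ((e j : U) : ι → ℝ) = j := fun j =>
    congrArg Subtype.val (Basis.span_apply hli j)
  set N : (ι → ℝ) → ℝ := fun g => g ⬝ᵥ c - g ⬝ᵥ ζ with hNdef
  have hNcont : Continuous N := by simp only [hNdef, dotProduct]; fun_prop
  have hN0 : ∀ g ∈ QQ D c, 0 ≤ N g := fun g h => sub_nonneg.2 (h ζ hζ)
  have hdetcont : Continuous fun v : b → U => e.det v := by
    simp only [Basis.det_apply]
    apply Continuous.matrix_det
    refine continuous_matrix fun i j => ?_
    simp only [Basis.toMatrix_apply]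
    have h1 : Continuous (e.coord i) := LinearMap.continuous_of_finiteDimensional _
    exact h1.comp (continuous_apply j)
  set S0 := ∑ j, N (e j : U) with hS0
  set 𝒦 : Set (b → U) := {v | ((∀ j, (v j : ι → ℝ) ∈ QQ D c) ∧ 1 ≤ |e.det v|) ∧
    ∑ j, N (v j) ≤ S0} with h𝒦
  have hsumcont : Continuous fun v : b → U => ∑ j, N (v j) := by fun_prop
  have hclosed : IsClosed 𝒦 := by
    have h1 : IsClosed {v : b → U | ∀ j, (v j : ι → ℝ) ∈ QQ D c} := by
      have : {v : b → U | ∀ j, (v j : ι → ℝ) ∈ QQ D c} =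
          ⋂ j, (fun v : b → U => (v j : ι → ℝ)) ⁻¹' QQ D c := by ext; simp
      rw [this]
      refine isClosed_iInter fun j => QQ_isClosed.preimage (by fun_prop)
    have h2 : IsClosed {v : b → U | 1 ≤ |e.det v|} :=
      isClosed_le continuous_const hdetcont.abs
    have h3 : IsClosed {v : b → U | ∑ j, N (v j) ≤ S0} := isClosed_le hsumcont continuous_const
    exact (h1.inter h2).inter h3
  have hbdd : Bornology.IsBounded 𝒦 := by
    rw [isBounded_iff_forall_norm_le]
    refine ⟨|C * S0|, ?_⟩
    rintro v ⟨⟨hv, -⟩, hS⟩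
    rw [pi_norm_le_iff_of_nonneg (abs_nonneg _)]
    intro j
    rw [Submodule.coe_norm, pi_norm_le_iff_of_nonneg (abs_nonneg _)]
    intro i
    have h1 := hC _ (hv j) i
    have h2 : N (v j) ≤ ∑ j, N (v j) :=
      Finset.single_le_sum (f := fun j => N (v j)) (fun k _ => hN0 _ (hv k)) (Finset.mem_univ j)
    rw [Real.norm_eq_abs]
    calc _ ≤ C * N (v j) := h1
      _ ≤ C * S0 := mul_le_mul_of_nonneg_left (h2.trans hS) hC0
      _ ≤ _ := le_abs_self _
  have hcompact : IsCompact 𝒦 := Metric.isCompact_of_isClosed_isBounded hclosed hbdd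
  have hemem : (fun j => e j) ∈ 𝒦 := by
    refine ⟨⟨fun j => ?_, ?_⟩, le_rfl⟩
    · rw [he]; exact hbQ j.2
    · have : e.det (fun j => e j) = 1 := e.det_self
      rw [this]; simp
  obtain ⟨v, ⟨⟨hv, hdet⟩, hvS⟩, hmin⟩ := hcompact.exists_isMinOn ⟨_, hemem⟩ hsumcont.continuousOn
  have hsumQ : ∑ j, (v j : ι → ℝ) ∈ QQ D c :=
    Finset.sum_induction _ (· ∈ QQ D c) (fun _ _ => QQ_add) QQ_zero fun j _ => hv j
  have hnonpos : ∀ i, (∑ j, (v j : ι → ℝ)) i ≤ 0 := by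
    intro i
    rcases eq_or_lt_of_le (hP i) with hi | hi
    · have hTU : ∀ x ∈ U, TT B i x ∈ U := by
        intro x hx
        rw [hUQ] at hx ⊢
        have : Submodule.map (TT B i) (Submodule.span ℝ (QQ D c)) ≤
            Submodule.span ℝ (QQ D c) := by
          rw [Submodule.map_span, Submodule.span_le]
          rintro _ ⟨y, hy, rfl⟩
          exact Submodule.subset_span (QQ_refl hD hi.symm hy)
        exact this (Submodule.mem_map_of_mem hx)
      set T : U →ₗ[ℝ] U := (TT B i).restrict hTU with hT
      have hTT : T ∘ₗ T = LinearMap.id := by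
        ext x : 2
        simp [hT, LinearMap.restrict_apply, TT_invol hg]
      have hdetT : |LinearMap.det T| = 1 := by
        have h1 : LinearMap.det T * LinearMap.det T = 1 := by
          rw [← LinearMap.det_comp, hTT, LinearMap.det_id]
        rcases mul_self_eq_one_iff.1 h1 with h | h <;> simp [h]
      have hTv : ∀ j, ((T (v j) : U) : ι → ℝ) = TT B i (v j) := fun j => rfl
      have hNT : ∀ j, N (T (v j) : U) = N (v j) - (v j : ι → ℝ) i * PP B p ζ i := by
        intro j
        simp only [hNdef, hTv]
        rw [TT_dot (p := p), TT_dot (p := p), ← hi]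
        simp only [dotProduct_add, dotProduct_smul, dotProduct_single, smul_eq_mul]
        ring
      by_contra! hpos
      have hsumT : ∑ j, N (T (v j) : U) =
          ∑ j, N (v j) - (∑ j, (v j : ι → ℝ)) i * PP B p ζ i := by
        simp only [hNT, Finset.sum_sub_distrib, Finset.sum_apply, Finset.sum_mul]
      have hlt := mul_pos hpos (hζP i)
      have hmem : (fun j => T (v j)) ∈ 𝒦 := by
        refine ⟨⟨fun j => ?_, ?_⟩, ?_⟩
        · rw [hTv]; exact QQ_refl hD hi.symm (hv j)
        · have : e.det (fun j => T (v j)) = LinearMap.det T * e.det v := e.det_comp T v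
          rw [this, abs_mul, hdetT, one_mul]; exact hdet
        · rw [hsumT]; linarith
      have h1 : ∑ j, N (v j) ≤ ∑ j, N (T (v j) : U) := hmin hmem
      linarith
    · exact QQ_nonpos hD hcD hi hsumQ
  have hsum0 := QQ_eq_zero_of_nonpos hD hc hsumQ hnonpos
  have hNsum : ∑ j, N (v j) = 0 := by
    have : ∑ j, N (v j) = N (∑ j, (v j : ι → ℝ)) := by
      simp only [hNdef, sum_dotProduct, Finset.sum_sub_distrib]
    rw [this, hsum0]; simp [hNdef]
  have hv0 : ∀ j, v j = 0 := by
    intro j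
    have h1 := (Finset.sum_eq_zero_iff_of_nonneg (fun k _ => hN0 _ (hv k))).1 hNsum j
      (Finset.mem_univ _)
    ext i
    have h2 := hC _ (hv j) i
    have h3 : (v j : ι → ℝ) ⬝ᵥ c - (v j : ι → ℝ) ⬝ᵥ ζ = 0 := h1
    rw [h3, mul_zero] at h2
    simpa using abs_nonpos_iff.1 h2
  intro g hgQ
  by_contra hne
  have hbne : Nonempty b := by
    by_contra hb
    rw [not_nonempty_iff] at hb
    have : g ∈ U := by rw [hUQ]; exact Submodule.subset_span hgQ
    rw [hU, Set.range_eq_empty] at this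
    simp at this
    exact hne this
  have : v = 0 := funext hv0
  rw [this, AlternatingMap.map_zero] at hdet
  norm_num at hdet

/-- Main abstract convexity theorem. -/
theorem Good.mem_interior (hg : Good B p) (hD : Stab B p D) {c : ι → ℝ} (hc : ∀ i, 0 < c i)
    (hP : ∀ i, 0 ≤ PP B p c i) : c ∈ interior D := by
  by_contra hcon
  obtain ⟨f, hf⟩ := geometric_hahn_banach_open_point hD.cvx.interior isOpen_interior hcon
  obtain ⟨x0, hx0⟩ := hg.interior_nonempty hD
  have hfdot : ∀ x, f x = (fun i => f (Pi.single i 1)) ⬝ᵥ x := by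
    intro x
    conv_lhs => rw [pi_eq_sum_univ' x]
    simp [dotProduct, mul_comm]
  have hQ : (fun i => f (Pi.single i 1)) ∈ QQ (closure D) c := by
    intro x hx
    rw [← hfdot, ← hfdot]
    rw [← hD.cvx.closure_interior_eq_closure_of_nonempty_interior ⟨x0, hx0⟩] at hx
    have : closure (interior D) ⊆ {x | f x ≤ f c} :=
      closure_minimal (fun y hy => (hf y hy).le) (isClosed_le f.continuous continuous_const)
    exact this hx
  have h0 := hg.QQ_trivial hD.closure hc (hg.mem_closure hD hc hP) hP _ hQ
  have h1 := hf x0 hx0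
  rw [hfdot, hfdot, h0] at h1
  simp at h1

end abstractPart
end Aux8
end

noncomputable section
namespace Aux8

section rankTwo

/-- Positivity of the rank two recursion, case `ab ≥ 4`. -/
lemma rank2_inf {a b : ℝ} (ha : 0 < a) (hb : 0 < b) (hab : 4 ≤ a * b) {g h : ℕ → ℝ}
    (g0 : 0 ≤ g 0) (h0 : 0 ≤ h 0) (g1 : g 1 = g 0 + a * h 0) (h1 : h 1 = h 0 + b * g 0)
    (gs : ∀ k, g (k + 2) = -g k + a * h (k + 1)) (hs : ∀ k, h (k + 2) = -h k + b * g (k + 1)) :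
    ∀ k, 0 ≤ g k := by
  set x := Real.sqrt a with hx
  set y := Real.sqrt b with hy
  have hx0 : 0 < x := Real.sqrt_pos.2 ha
  have hy0 : 0 < y := Real.sqrt_pos.2 hb
  have hxa : a = x * x := (Real.mul_self_sqrt ha.le).symm
  have hyb : b = y * y := (Real.mul_self_sqrt hb.le).symm
  have hxy : 2 ≤ x * y := by
    rw [hxa, hyb] at hab
    by_contra! hlt
    have : 0 < x * y := by positivity
    nlinarith
  have key : ∀ k, 0 ≤ g k ∧ 0 ≤ h k ∧ x * h k ≤ y * g (k + 1) ∧ y * g k ≤ x * h (k + 1) := by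
    intro k
    induction k with
    | zero =>
      refine ⟨g0, h0, ?_, ?_⟩
      · rw [zero_add, g1, hxa]
        have e : y * (g 0 + x * x * h 0) - x * h 0 = y * g 0 + (x * y - 1) * (x * h 0) := by ring
        have : 0 ≤ y * g 0 := by positivity
        have : 0 ≤ (x * y - 1) * (x * h 0) := mul_nonneg (by linarith) (by positivity)
        linarith
      · rw [zero_add, h1, hyb]
        have e : x * (h 0 + y * y * g 0) - y * g 0 = x * h 0 + (x * y - 1) * (y * g 0) := by ring
        have : 0 ≤ x * h 0 := by positivity
        have : 0 ≤ (x * y - 1) * (y * g 0) := mul_nonneg (by linarith) (by positivity)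
        linarith
    | succ k ih =>
      obtain ⟨ig, ih', i1, i2⟩ := ih
      have p1 : 0 ≤ y * g (k + 1) := le_trans (by positivity) i1
      have p2 : 0 ≤ x * h (k + 1) := le_trans (by positivity) i2
      have q1 : 0 ≤ g (k + 1) := nonneg_of_mul_nonneg_right p1 hy0
      have q2 : 0 ≤ h (k + 1) := nonneg_of_mul_nonneg_right p2 hx0
      refine ⟨q1, q2, ?_, ?_⟩
      · rw [show k + 1 + 1 = k + 2 from rfl, gs, hxa]
        have e : y * (-g k + x * x * h (k + 1)) - x * h (k + 1)
          = (x * h (k + 1) - y * g k) + (x * y - 2) * (x * h (k + 1)) := by ring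
        have : 0 ≤ (x * y - 2) * (x * h (k + 1)) := mul_nonneg (by linarith) p2
        linarith
      · rw [show k + 1 + 1 = k + 2 from rfl, hs, hyb]
        have e : x * (-h k + y * y * g (k + 1)) - y * g (k + 1)
          = (y * g (k + 1) - x * h k) + (x * y - 2) * (y * g (k + 1)) := by ring
        have : 0 ≤ (x * y - 2) * (y * g (k + 1)) := mul_nonneg (by linarith) p1
        linarith
  exact fun k => (key k).1

end rankTwo

section weyl

/-- The entries of the Coxeter matrix. -/
def cmEntry (n : ℤ) : ℕ :=
  if n = 0 then 2 else if n = 1 then 3 else if n = 2 then 4 else if n = 3 then 6 else 0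

lemma cmEntry_ne_one (n : ℤ) : cmEntry n ≠ 1 := by
  unfold cmEntry; split_ifs <;> norm_num

/-- Positivity of the rank two recursion in general. -/
lemma rank2 {A B : ℤ} (hA : A ≤ 0) (hB : B ≤ 0) (hz : A = 0 ↔ B = 0) {g h : ℕ → ℝ}
    (g0 : 0 ≤ g 0) (h0 : 0 ≤ h 0) (g1 : g 1 = g 0 - A * h 0) (h1 : h 1 = h 0 - B * g 0)
    (gs : ∀ k, g (k + 2) = -g k - A * h (k + 1)) (hs : ∀ k, h (k + 2) = -h k - B * g (k + 1))
    (k : ℕ) (hk : cmEntry (A * B) ≠ 0 → k < cmEntry (A * B)) : 0 ≤ g k := by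
  obtain ⟨a, rfl⟩ : ∃ a, A = -a := ⟨-A, by ring⟩
  obtain ⟨b, rfl⟩ : ∃ b, B = -b := ⟨-B, by ring⟩
  have ha : 0 ≤ a := by linarith
  have hb : 0 ≤ b := by linarith
  have haR : (0:ℝ) ≤ a := by exact_mod_cast ha
  have hbR : (0:ℝ) ≤ b := by exact_mod_cast hb
  have eab : -a * -b = a * b := by ring
  rw [eab] at hk
  push_cast at g1 h1 gs hs
  have hprod : 0 ≤ a * b := mul_nonneg ha hb
  by_cases h4 : 4 ≤ a * b
  · have ha0 : a ≠ 0 := by rintro rfl; norm_num at h4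
    have hb0 : b ≠ 0 := by rintro rfl; norm_num at h4
    refine rank2_inf (a := a) (b := b) ?_ ?_ (by exact_mod_cast h4) g0 h0 (by linarith)
      (by linarith) (fun k => by rw [gs]; ring) (fun k => by rw [hs]; ring) k
    · exact_mod_cast lt_of_le_of_ne ha (Ne.symm ha0)
    · exact_mod_cast lt_of_le_of_ne hb (Ne.symm hb0)
  · have hlt : a * b < 4 := by linarith
    have hg2 := gs 0
    have hg3 := gs 1
    have hg4 := gs 2
    have hg5 := gs 3
    have hh2 := hs 0
    have hh3 := hs 1
    have hh4 := hs 2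
    norm_num at hg2 hg3 hg4 hg5 hh2 hh3 hh4
    have pa : 0 ≤ (a:ℝ) * h 0 := mul_nonneg haR h0
    have pb : 0 ≤ (b:ℝ) * g 0 := mul_nonneg hbR g0
    generalize hn : a * b = n at *
    have hnR : (a:ℝ) * b = n := by exact_mod_cast hn
    have e2 : g 2 = (n - 1) * g 0 + a * h 0 := by rw [hg2, h1, ← hnR]; ring
    have f2 : h 2 = (n - 1) * h 0 + b * g 0 := by rw [hh2, g1, ← hnR]; ring
    have e3 : g 3 = (n - 1) * g 0 + (n - 2) * (a * h 0) := by rw [hg3, f2, g1, ← hnR]; ring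
    have f3 : h 3 = (n - 1) * h 0 + (n - 2) * (b * g 0) := by rw [hh3, e2, h1, ← hnR]; ring
    have e4 : g 4 = (n * (n - 2) - (n - 1)) * g 0 + (n - 2) * (a * h 0) := by
      rw [hg4, f3, e2, ← hnR]; ring
    have f4 : h 4 = (n * (n - 2) - (n - 1)) * h 0 + (n - 2) * (b * g 0) := by
      rw [hh4, e3, f2, ← hnR]; ring
    have e5 : g 5 = (n * (n - 2) - (n - 1)) * g 0
        + (n * (n - 2) - (n - 1) - (n - 2)) * (a * h 0) := by
      rw [hg5, f4, e3, ← hnR]; ring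
    interval_cases n
    · have hk' : k < 2 := by simpa [cmEntry] using hk
      interval_cases k
      · exact g0
      · rw [g1]; linarith
    · have hk' : k < 3 := by simpa [cmEntry] using hk
      norm_num at e2
      interval_cases k <;> linarith
    · have hk' : k < 4 := by simpa [cmEntry] using hk
      norm_num at e2 e3
      interval_cases k <;> linarith
    · have hk' : k < 6 := by simpa [cmEntry] using hk
      norm_num at e2 e3 e4 e5
      interval_cases k <;> linarith

variable {ι : Type*} {V : Type*} [AddCommGroup V] [Module ℝ V]

/-- Data of roots and coroots. -/
structure Datum (A : ι → ι → ℤ) (α : ι → V) (f : ι → V →ₗ[ℝ] ℝ) (s : ι → V ≃ₗ[ℝ] V) :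
    Prop where
  diag : ∀ i, A i i = 2
  off : ∀ i j, i ≠ j → A i j ≤ 0
  zero : ∀ i j, A i j = 0 ↔ A j i = 0
  pair : ∀ i j, f i (α j) = (A i j : ℝ)
  s_apply : ∀ i x, s i x = x - f i x • α i

open Classical in
/-- The Coxeter matrix of a generalized Cartan matrix. -/
def cm (A : ι → ι → ℤ) : CoxeterMatrix ι where
  M := fun i j => if i = j then 1 else cmEntry (A i j * A j i)
  isSymm := by
    ext i j
    change (if j = i then 1 else cmEntry (A j i * A i j)) =
      (if i = j then 1 else cmEntry (A i j * A j i))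
    by_cases h : i = j
    · subst h; simp
    · rw [if_neg h, if_neg (Ne.symm h), mul_comm]
  diagonal := by simp
  off_diagonal := by
    intro i j h
    simp only [if_neg h]
    exact cmEntry_ne_one _

lemma cm_apply_ne (A : ι → ι → ℤ) {i j : ι} (h : i ≠ j) : cm A i j = cmEntry (A i j * A j i) := by
  classical
  exact if_neg h

variable {A : ι → ι → ℤ} {α : ι → V} {f : ι → V →ₗ[ℝ] ℝ} {s : ι → V ≃ₗ[ℝ] V}

lemma Datum.cube (d : Datum A α f s) (i j : ι) (x : V) :
    s i (s j (s i (s j (s i (s j x))))) =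
      ((A i j * A j i : ℤ) - 1 : ℝ) • (s i (s j (s i (s j x))))
      - ((A i j * A j i : ℤ) - 1 : ℝ) • (s i (s j x)) + x := by
  simp only [d.s_apply, map_sub, map_smul, d.pair, d.diag, smul_eq_mul]
  push_cast
  module

lemma Datum.liftable (d : Datum A α f s) : (cm A).IsLiftable s := by
  intro i j
  by_cases h : i = j
  · subst h
    rw [(cm A).diagonal, pow_one]
    ext x
    simp only [LinearEquiv.mul_apply, LinearEquiv.coe_one, id, d.s_apply, map_sub, map_smul,
      d.pair, d.diag, smul_eq_mul]
    push_cast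
    module
  rw [cm_apply_ne A h]
  have hc := d.cube i j
  have hz := d.zero i j
  generalize hn : A i j * A j i = n at *
  unfold cmEntry
  split_ifs with h0 h1 h2 h3
  · subst h0
    have hA : A i j = 0 := by
      rcases mul_eq_zero.1 hn with h | h
      · exact h
      · exact hz.2 h
    have hA' := hz.1 hA
    ext x
    simp only [pow_succ, pow_zero, one_mul, LinearEquiv.mul_apply, LinearEquiv.coe_one, id, d.s_apply,
      map_sub, map_smul, d.pair, d.diag, smul_eq_mul, hA, hA']
    push_cast
    module
  · subst h1
    ext x
    simp only [pow_succ, pow_zero, one_mul, LinearEquiv.mul_apply, LinearEquiv.coe_one, id]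
    rw [hc]; push_cast; module
  · subst h2
    ext x
    simp only [pow_succ, pow_zero, one_mul, LinearEquiv.mul_apply, LinearEquiv.coe_one, id]
    rw [hc (s i (s j x)), hc]; push_cast; module
  · subst h3
    ext x
    simp only [pow_succ, pow_zero, one_mul, LinearEquiv.mul_apply, LinearEquiv.coe_one, id]
    rw [hc (s i (s j (s i (s j (s i (s j x)))))), hc (s i (s j (s i (s j x)))),
      hc (s i (s j x)), hc]
    push_cast; module
  · simp

/-- The representation of the abstract Coxeter group. -/
def Datum.rho (d : Datum A α f s) : (cm A).Group →* (V ≃ₗ[ℝ] V) :=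
  (cm A).toCoxeterSystem.lift ⟨s, d.liftable⟩

/-- Simple reflections of the abstract group. -/
abbrev sg (A : ι → ι → ℤ) (i : ι) : (cm A).Group := (cm A).toCoxeterSystem.simple i

/-- Length in the abstract group. -/
abbrev lg (A : ι → ι → ℤ) (w : (cm A).Group) : ℕ := (cm A).toCoxeterSystem.length w

lemma Datum.rho_simple (d : Datum A α f s) (i : ι) : d.rho (sg A i) = s i :=
  (cm A).toCoxeterSystem.lift_apply_simple d.liftable i

/-- Alternating products, starting with `s j`. -/
def alt (A : ι → ι → ℤ) : ℕ → ι → ι → (cm A).Group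
  | 0, _, _ => 1
  | k + 1, i, j => sg A j * alt A k j i

lemma alt_eq (k : ℕ) (i j : ι) :
    alt A k i j = ((cm A).toCoxeterSystem.wordProd (CoxeterSystem.alternatingWord i j k))⁻¹ := by
  induction k generalizing i j with
  | zero => simp [alt, CoxeterSystem.alternatingWord]
  | succ k ih =>
    rw [alt, ih, CoxeterSystem.alternatingWord_succ, CoxeterSystem.wordProd_concat, mul_inv_rev,
      CoxeterSystem.inv_simple]

lemma alt_braid (i j : ι) : alt A (cm A i j) i j = alt A (cm A i j) j i := by
  have := (cm A).toCoxeterSystem.wordProd_braidWord_eq i j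
  unfold CoxeterSystem.braidWord at this
  rw [alt_eq, alt_eq, this, (cm A).symmetric j i]

/-- The last letter appended to the alternating product. -/
def lst (k : ℕ) (i j : ι) : ι := if Even k then j else i

lemma alt_succ_right (k : ℕ) (i j : ι) : alt A (k + 1) i j = alt A k i j * sg A (lst k i j) := by
  induction k generalizing i j with
  | zero => simp [alt, lst]
  | succ k ih =>
    rw [alt, ih, ← mul_assoc, ← alt]
    congr 2
    by_cases h : Even k <;> simp [lst, Nat.even_add_one, h]

lemma length_alt (k : ℕ) (i j : ι) : lg A (alt A k i j) ≤ k := by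
  rw [alt_eq, lg, CoxeterSystem.length_inv]
  refine ((cm A).toCoxeterSystem.length_wordProd_le _).trans ?_
  rw [CoxeterSystem.length_alternatingWord]

lemma alt_add (k n : ℕ) (i j : ι) :
    ∃ r, alt A (k + n) i j = alt A k i j * r ∧ lg A r ≤ n := by
  induction n with
  | zero => exact ⟨1, by simp, by simp [lg]⟩
  | succ n ih =>
    obtain ⟨r, h1, h2⟩ := ih
    refine ⟨r * sg A (lst (k + n) i j), ?_, ?_⟩
    · rw [← add_assoc, alt_succ_right, h1, mul_assoc]
    · refine ((cm A).toCoxeterSystem.length_mul_le _ _).trans ?_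
      rw [CoxeterSystem.length_simple]
      exact Nat.add_le_add_right h2 1

/-- Rank two positivity along alternating products. -/
lemma Datum.alt_pos (d : Datum A α f s) {i j : ι} (hij : i ≠ j) {y : V} (hi : 0 ≤ f i y)
    (hj : 0 ≤ f j y) (k : ℕ) (hk : cm A i j ≠ 0 → k < cm A i j) :
    0 ≤ f i (d.rho (alt A k i j) y) := by
  rw [cm_apply_ne A hij] at hk
  have step1 : ∀ (i j : ι) (z : V), f i (s j z) = f i z - A i j * f j z := by
    intro i j z
    rw [d.s_apply, map_sub, map_smul, d.pair, smul_eq_mul]; ring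
  have stepi : ∀ (i : ι) (z : V), f i (s i z) = - f i z := by
    intro i z; rw [step1, d.diag]; push_cast; ring
  have rec2 : ∀ (i j : ι) (k : ℕ), f i (d.rho (alt A (k + 2) i j) y) =
      - f i (d.rho (alt A k i j) y) - A i j * f j (d.rho (alt A (k + 1) j i) y) := by
    intro i j k
    rw [show alt A (k + 2) i j = sg A j * (sg A i * alt A k i j) from rfl,
      show alt A (k + 1) j i = sg A i * alt A k i j from rfl]
    simp only [map_mul, LinearEquiv.mul_apply, d.rho_simple]
    rw [step1 i j, stepi]
  have rec1 : ∀ (i j : ι), f i (d.rho (alt A 1 i j) y) =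
      f i (d.rho (alt A 0 i j) y) - A i j * f j (d.rho (alt A 0 j i) y) := by
    intro i j
    rw [show alt A 1 i j = sg A j * 1 from rfl, show alt A 0 i j = 1 from rfl,
      show alt A 0 j i = 1 from rfl]
    simp only [map_mul, map_one, LinearEquiv.mul_apply, d.rho_simple]
    exact step1 i j y
  refine rank2 (A := A i j) (B := A j i) (g := fun k => f i (d.rho (alt A k i j) y))
    (h := fun k => f j (d.rho (alt A k j i) y)) (d.off i j hij) (d.off j i hij.symm)
    (d.zero i j) ?_ ?_ (rec1 i j) (rec1 j i) (rec2 i j) (rec2 j i) k hk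
  · simpa [alt] using hi
  · simpa [alt] using hj

/-- Key positivity: `⟨w x, α_i∨⟩ ≥ 0` for dominant `x` when `ℓ(s_i w) > ℓ(w)`. -/
lemma Datum.dominant (d : Datum A α f s) {x : V} (hx : ∀ i, 0 ≤ f i x) :
    ∀ (n : ℕ) (w : (cm A).Group), lg A w = n → ∀ i, lg A w < lg A (sg A i * w) →
      0 ≤ f i (d.rho w x) := by
  classical
  intro n
  induction n using Nat.strong_induction_on with
  | _ n ih =>
    intro w hw i hi
    by_cases hw1 : w = 1
    · subst hw1; simpa using hx i
    obtain ⟨j, hj⟩ := (cm A).toCoxeterSystem.exists_leftDescent_of_ne_one hw1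
    have hj' : lg A (sg A j * w) < lg A w := hj
    have hij : i ≠ j := by rintro rfl; omega
    let P : ℕ → Prop := fun k => ∃ v, w = alt A k i j * v ∧ lg A w = lg A v + k
    have hP1 : P 1 := by
      refine ⟨sg A j * w, ?_, ?_⟩
      · simp [alt]
      · have hl : lg A (sg A j * w) = lg A w + 1 ∨ lg A (sg A j * w) + 1 = lg A w :=
          (cm A).toCoxeterSystem.length_simple_mul w j
        rcases hl with h | h <;> omega
    have hPle : ∀ k, P k → k ≤ n := by
      rintro k ⟨v, -, h⟩; omega
    have h1n : 1 ≤ n := hPle 1 hP1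
    set k := Nat.findGreatest P n with hk
    have hPk : P k := Nat.findGreatest_spec h1n hP1
    have hk1 : 1 ≤ k := Nat.le_findGreatest h1n hP1
    have hmax : ¬ P (k + 1) := by
      intro h
      have := Nat.le_findGreatest (hPle _ h) h
      omega
    clear_value k
    obtain ⟨v, hwv, hlen⟩ := hPk
    have hasc : ∀ z, lg A (sg A z * v) = lg A v + 1 ∨ lg A (sg A z * v) + 1 = lg A v :=
      fun z => (cm A).toCoxeterSystem.length_simple_mul v z
    have hX : lg A v < lg A (sg A (lst k i j) * v) := by
      rcases hasc (lst k i j) with h | h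
      · omega
      · exfalso
        apply hmax
        refine ⟨sg A (lst k i j) * v, ?_, by omega⟩
        rw [alt_succ_right, mul_assoc, CoxeterSystem.simple_mul_simple_cancel_left]
        exact hwv
    obtain ⟨k', rfl⟩ : ∃ k', k = k' + 1 := ⟨k - 1, by omega⟩
    have hY : lg A v < lg A (sg A (lst k' i j) * v) := by
      rcases hasc (lst k' i j) with h | h
      · omega
      · exfalso
        have h1 : w = alt A k' i j * (sg A (lst k' i j) * v) := by
          rw [hwv, alt_succ_right, mul_assoc]
        have h2 : lg A w ≤ lg A (alt A k' i j) + lg A (sg A (lst k' i j) * v) := by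
          conv_lhs => rw [h1]
          exact (cm A).toCoxeterSystem.length_mul_le _ _
        have h3 := length_alt (A := A) k' i j
        omega
    have hboth : lg A v < lg A (sg A i * v) ∧ lg A v < lg A (sg A j * v) := by
      by_cases he : Even k'
      · rw [lst, if_pos he] at hY
        rw [lst, if_neg (by simpa [Nat.even_add_one] using he)] at hX
        exact ⟨hX, hY⟩
      · rw [lst, if_neg he] at hY
        rw [lst, if_pos (by simpa [Nat.even_add_one] using he)] at hX
        exact ⟨hY, hX⟩
    have hvi := ih (lg A v) (by omega) v rfl i hboth.1
    have hvj := ih (lg A v) (by omega) v rfl j hboth.2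
    rw [hwv, map_mul, LinearEquiv.mul_apply]
    refine d.alt_pos hij hvi hvj _ ?_
    intro hm
    by_contra! hle
    obtain ⟨l, hl⟩ : ∃ l, k' + 1 = cm A i j + l := ⟨k' + 1 - cm A i j, by omega⟩
    obtain ⟨r, hr1, hr2⟩ := alt_add (A := A) (cm A i j) l i j
    obtain ⟨m', hm'⟩ : ∃ m', cm A i j = m' + 1 := ⟨cm A i j - 1, by omega⟩
    have hb := alt_braid (A := A) i j
    have h1 : sg A i * w = alt A m' i j * r * v := by
      rw [hwv, hl, hr1, hb, hm', alt]
      simp only [mul_assoc]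
      rw [CoxeterSystem.simple_mul_simple_cancel_left]
    have h2 : lg A (alt A m' i j * r * v) ≤ lg A (alt A m' i j) + lg A r + lg A v :=
      ((cm A).toCoxeterSystem.length_mul_le _ _).trans
        (Nat.add_le_add_right ((cm A).toCoxeterSystem.length_mul_le _ _) _)
    have h3 := length_alt (A := A) m' i j
    rw [h1] at hi
    omega

/-- Combinatorial form of `μ`-connectedness of `K`. -/
def HC (A : ι → ι → ℤ) (p : ι → ℝ) (K : Set ι) : Prop :=
  ∀ Z ⊆ K, Z.Nonempty → ∃ i ∈ Z, p i ≠ 0 ∨ ∃ j ∈ K, j ∉ Z ∧ A i j ≠ 0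

lemma HC.insert {p : ι → ℝ} {K : Set ι} (h : HC A p K) {i : ι}
    (hi : p i ≠ 0 ∨ ∃ j ∈ K, A i j ≠ 0) : HC A p (insert i K) := by
  intro Z hZ hne
  by_cases hZK : (Z ∩ K).Nonempty
  · obtain ⟨k, hk, h1⟩ := h _ inter_subset_right hZK
    refine ⟨k, hk.1, h1.imp id ?_⟩
    rintro ⟨j, hj, hj2, hj3⟩
    exact ⟨j, mem_insert_of_mem _ hj, fun hjZ => hj2 ⟨hjZ, hj⟩, hj3⟩
  · obtain ⟨z, hz⟩ := hne
    have hzi : z = i := by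
      rcases hZ hz with h | h
      · exact h
      · exact absurd ⟨z, hz, h⟩ hZK
    subst hzi
    refine ⟨z, hz, hi.imp id ?_⟩
    rintro ⟨j, hj, hj3⟩
    exact ⟨j, mem_insert_of_mem _ hj, fun hjZ => hZK ⟨j, hjZ, hj⟩, hj3⟩

lemma HC.union {p : ι → ℝ} {K L : Set ι} (h : HC A p K) (h' : HC A p L) : HC A p (K ∪ L) := by
  intro Z hZ hne
  by_cases hZK : (Z ∩ K).Nonempty
  · obtain ⟨k, hk, h1⟩ := h _ inter_subset_right hZK
    refine ⟨k, hk.1, h1.imp id ?_⟩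
    rintro ⟨j, hj, hj2, hj3⟩
    exact ⟨j, Or.inl hj, fun hjZ => hj2 ⟨hjZ, hj⟩, hj3⟩
  · have hZL : Z ⊆ L := by
      intro z hz
      rcases hZ hz with h | h
      · exact absurd ⟨z, hz, h⟩ hZK
      · exact h
    obtain ⟨k, hk, h1⟩ := h' Z hZL hne
    refine ⟨k, hk, h1.imp id ?_⟩
    rintro ⟨j, hj, hj2, hj3⟩
    exact ⟨j, Or.inr hj, hj2, hj3⟩

variable [Fintype ι] [DecidableEq ι]

/-- Orbit elements lie below `x`, with connected support. -/
lemma Datum.orbit (d : Datum A α f s) {x : V} (hx : ∀ i, 0 ≤ f i x) :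
    ∀ (n : ℕ) (w : (cm A).Group), lg A w = n → ∃ c : ι → ℝ, (∀ i, 0 ≤ c i) ∧
      HC A (fun i => f i x) {i | c i ≠ 0} ∧ d.rho w x = x - ∑ i, c i • α i := by
  intro n
  induction n with
  | zero =>
    intro w hw
    have : w = 1 := (cm A).toCoxeterSystem.length_eq_zero_iff.1 hw
    subst this
    refine ⟨0, by simp, ?_, by simp⟩
    intro Z hZ hne
    obtain ⟨z, hz⟩ := hne
    exact absurd rfl (hZ hz)
  | succ n ih =>
    intro w hw
    have hw1 : w ≠ 1 := by
      rintro rfl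
      simp [lg] at hw
    obtain ⟨i, hi⟩ := (cm A).toCoxeterSystem.exists_leftDescent_of_ne_one hw1
    rw [CoxeterSystem.isLeftDescent_iff] at hi
    have hv : lg A (sg A i * w) = n := by
      change lg A (sg A i * w) + 1 = lg A w at hi
      omega
    have hwv : w = sg A i * (sg A i * w) := by simp
    generalize sg A i * w = v at *
    subst hwv
    have hpos := d.dominant hx n v hv i (by omega)
    obtain ⟨c, hc0, hcHC, hceq⟩ := ih v hv
    set t := f i (d.rho v x) with ht
    refine ⟨c + t • Pi.single i 1, ?_, ?_, ?_⟩
    · intro j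
      have h2 : (0:ℝ) ≤ (Pi.single i 1 : ι → ℝ) j := by
        by_cases hj : j = i
        · subst hj; simp
        · simp [Pi.single_eq_of_ne hj]
      have := hc0 j
      simp only [Pi.add_apply, Pi.smul_apply, smul_eq_mul]
      positivity
    · rcases eq_or_lt_of_le hpos with h0 | h0
      · rw [← h0]; simpa using hcHC
      have hset : {j | (c + t • Pi.single i 1 : ι → ℝ) j ≠ 0} = insert i {j | c j ≠ 0} := by
        ext j
        by_cases hj : j = i
        · subst hj
          have := hc0 j
          simp; linarith
        · simp [Pi.single_eq_of_ne hj, hj]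
      rw [hset]
      apply hcHC.insert
      by_contra! hcon
      obtain ⟨h1, h2⟩ := hcon
      rw [ht, hceq, map_sub, map_sum, h1] at h0
      have : ∑ j, f i (c j • α j) = 0 := by
        apply Finset.sum_eq_zero
        intro j _
        by_cases hcj : c j = 0
        · simp [hcj]
        · rw [map_smul, d.pair, h2 j hcj]; simp
      rw [this] at h0
      norm_num at h0
    · rw [map_mul, LinearEquiv.mul_apply, d.rho_simple, d.s_apply, ← ht, hceq]
      have : ∑ j, (c + t • Pi.single i 1 : ι → ℝ) j • α j = ∑ j, c j • α j + t • α i := by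
        simp only [Pi.add_apply, add_smul, Finset.sum_add_distrib]
        congr 1
        rw [Finset.sum_eq_single i]
        · simp
        · intro b _ hb; simp [Pi.single_eq_of_ne hb]
        · simp
      rw [this]; abel

lemma Datum.orbit' (d : Datum A α f s) {x : V} (hx : ∀ i, 0 ≤ f i x) {w : V ≃ₗ[ℝ] V}
    (hw : w ∈ Subgroup.closure (Set.range s)) : ∃ c : ι → ℝ, (∀ i, 0 ≤ c i) ∧
      HC A (fun i => f i x) {i | c i ≠ 0} ∧ w x = x - ∑ i, c i • α i := by
  have : Subgroup.closure (Set.range s) ≤ d.rho.range := by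
    rw [Subgroup.closure_le]
    rintro _ ⟨i, rfl⟩
    exact ⟨sg A i, d.rho_simple i⟩
  obtain ⟨w', rfl⟩ := this hw
  exact d.orbit hx _ w' rfl

end weyl
end Aux8
end


noncomputable section
namespace Aux8
open Topology

lemma intrinsicInterior_image_of_inj {E V : Type*} [NormedAddCommGroup E] [NormedSpace ℝ E]
    [NormedAddCommGroup V] [NormedSpace ℝ V] (φ : E →ᵃ[ℝ] V) (hφ : IsEmbedding φ)
    {D : Set E} (hD : (interior D).Nonempty) :
    intrinsicInterior ℝ (φ '' D) = φ '' interior D := by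
  have hspan : (affineSpan ℝ (φ '' D) : Set V) = range φ := by
    rw [← AffineSubspace.map_span, affineSpan_eq_top_of_nonempty_interior
      (hD.mono (interior_mono (subset_convexHull ℝ D)))]
    simp
  let e : E → affineSpan ℝ (φ '' D) := fun x => ⟨φ x, by
    have : φ x ∈ (affineSpan ℝ (φ '' D) : Set V) := by rw [hspan]; exact ⟨x, rfl⟩
    exact this⟩
  have he : IsEmbedding e := by
    refine IsEmbedding.of_comp ?_ continuous_subtype_val hφ
    exact hφ.continuous.subtype_mk _
  have hs : Function.Surjective e := by
    rintro ⟨y, hy⟩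
    have : y ∈ (affineSpan ℝ (φ '' D) : Set V) := hy
    rw [hspan] at this
    obtain ⟨x, rfl⟩ := this
    exact ⟨x, rfl⟩
  let h : E ≃ₜ affineSpan ℝ (φ '' D) := he.toHomeomorphOfSurjective hs
  have hpre : ((↑) ⁻¹' (φ '' D) : Set (affineSpan ℝ (φ '' D))) = h '' D := by
    ext ⟨y, hy⟩
    constructor
    · rintro ⟨x, hx, hxy⟩
      exact ⟨x, hx, Subtype.ext hxy⟩
    · rintro ⟨x, hx, hxy⟩
      exact ⟨x, hx, congrArg Subtype.val hxy⟩
  rw [intrinsicInterior, hpre, ← h.image_interior, image_image]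
  rfl

end Aux8

namespace GCMRealization
variable {m : ℕ} {V : Type*} [NormedAddCommGroup V] [NormedSpace ℝ V]
variable (S : GCMRealization m V)
open Aux8 Topology

lemma s_apply' (i : Fin m) (x : V) : S.s i x = x - S.coroot i x • S.root i := rfl

lemma datum (I : Set (Fin m)) : Datum (fun i j : I => S.A i j) (fun i => S.root i)
    (fun i => S.coroot i) (fun i => S.s i) where
  diag i := S.A_diag i
  off i j h := S.A_offdiag i j (fun h' => h (Subtype.ext h'))
  zero i j := S.A_zero_iff i j
  pair i j := S.pairing i j
  s_apply i x := S.s_apply' i x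

lemma WI_eq (I : Set (Fin m)) : S.WI I = Subgroup.closure (range fun i : I => S.s i) := by
  rw [WI, image_eq_range]

/-- Points below `μ` with connected support inside `I`. -/
def below (μ : V) (I : Set (Fin m)) : Set V :=
  {x | ∃ c : Fin m → ℝ, (∀ i, 0 ≤ c i) ∧ (∀ i, i ∉ I → c i = 0) ∧
    HC (fun i j => S.A i j) (fun i => S.coroot i μ) {i | c i ≠ 0} ∧ x = μ - ∑ i, c i • S.root i}

lemma below_convex (μ : V) (I : Set (Fin m)) : Convex ℝ (S.below μ I) := by
  rw [convex_iff_forall_pos]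
  rintro x ⟨c, hc, hcI, hcH, rfl⟩ y ⟨d, hd, hdI, hdH, rfl⟩ a b ha hb hab
  refine ⟨a • c + b • d, ?_, ?_, ?_, ?_⟩
  · intro i
    have := hc i
    have := hd i
    simp only [Pi.add_apply, Pi.smul_apply, smul_eq_mul]
    positivity
  · intro i hi
    simp [hcI i hi, hdI i hi]
  · have : {i | (a • c + b • d) i ≠ 0} = {i | c i ≠ 0} ∪ {i | d i ≠ 0} := by
      ext i
      have h1 := hc i
      have h2 := hd i
      simp only [Pi.add_apply, Pi.smul_apply, smul_eq_mul, mem_ofPred_eq, mem_union]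
      rw [← not_and_or, not_iff_not, add_eq_zero_iff_of_nonneg (by positivity) (by positivity)]
      simp [ha.ne', hb.ne']
    rw [this]
    exact hcH.union hdH
  · obtain rfl : b = 1 - a := by linarith
    simp only [Pi.add_apply, Pi.smul_apply, smul_eq_mul, add_smul, mul_smul,
      Finset.sum_add_distrib, ← Finset.smul_sum]
    module

lemma sum_ext (I : Set (Fin m)) [Fintype I] (c : Fin m → ℝ) (hc : ∀ i, i ∉ I → c i = 0) :
    ∑ i : I, c i • S.root i = ∑ i, c i • S.root i := by
  apply Fintype.sum_of_injective (Subtype.val) Subtype.val_injective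
  · intro i hi
    rw [hc i (by simpa using hi), zero_smul]
  · intro i; rfl

lemma face_subset (μ : V) (hμ : μ ∈ S.chamber) (I : Set (Fin m)) :
    S.face μ I ⊆ S.below μ I := by
  classical
  apply convexHull_min _ (S.below_convex μ I)
  rintro _ ⟨w, hw, rfl⟩
  rw [SetLike.mem_coe, WI_eq] at hw
  obtain ⟨c, hc, hH, he⟩ := (S.datum I).orbit' (x := μ) (fun i => hμ i) hw
  have hx : ∀ i : I, (fun i : Fin m => if h : i ∈ I then c ⟨i, h⟩ else 0) i = c i := by
    intro i; simp
  have hz : ∀ i, i ∉ I → (fun i : Fin m => if h : i ∈ I then c ⟨i, h⟩ else 0) i = 0 := by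
    intro i hi; simp [hi]
  generalize (fun i : Fin m => if h : i ∈ I then c ⟨i, h⟩ else 0) = c' at hx hz
  refine ⟨c', ?_, hz, ?_, ?_⟩
  · intro i
    by_cases h : i ∈ I
    · have := hc ⟨i, h⟩; rw [← hx] at this; exact this
    · rw [hz i h]
  · rintro Z hZ ⟨z, hzZ⟩
    have hsub : ∀ z ∈ Z, z ∈ I := fun z hzZ => by
      by_contra h; exact hZ hzZ (hz z h)
    obtain ⟨i, hi, h⟩ := hH (Subtype.val ⁻¹' Z) (fun i hi => by
      have := hZ hi
      simpa [hx] using this) ⟨⟨z, hsub z hzZ⟩, hzZ⟩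
    refine ⟨i, hi, h.imp id ?_⟩
    rintro ⟨j, hj, hjZ, hA⟩
    exact ⟨j, by simpa [hx] using hj, hjZ, hA⟩
  · simp only
    rw [he, ← S.sum_ext I c' hz]
    simp [hx]

lemma muConnected_of_HC {μ : V} {K : Set (Fin m)}
    (h : HC (fun i j => S.A i j) (fun i => S.coroot i μ) K) : S.MuConnected μ K := by
  intro i
  by_contra hcon
  push Not at hcon
  obtain ⟨k, ⟨hkK, hk⟩, h1 | ⟨j, hjK, hjZ, hA⟩⟩ := h
    {j | ∃ hj : j ∈ K, (S.diagram.induce K).Reachable i ⟨j, hj⟩}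
    (fun j hj => hj.1) ⟨i, i.2, SimpleGraph.Reachable.refl _⟩
  · exact hcon ⟨k, hkK⟩ h1 hk
  · apply hjZ
    refine ⟨hjK, hk.trans ?_⟩
    apply SimpleGraph.Adj.reachable
    refine ⟨?_, hA, fun h => hA ((S.A_zero_iff _ _).1 h)⟩
    rintro rfl
    exact hjZ ⟨hkK, hk⟩

lemma good {μ : V} (hμ : μ ∈ S.chamber) {K : Set (Fin m)} (h : S.MuConnected μ K) :
    Good (fun i j : K => (S.A i j : ℝ)) (fun i : K => S.coroot i μ) where
  diag i := by simp [S.A_diag]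
  off i j hij := by
    have := S.A_offdiag i j (fun h' => hij (Subtype.ext h'))
    exact_mod_cast this
  pos i := hμ i
  conn Z hne := by
    by_contra hcon
    push Not at hcon
    obtain ⟨i, hi⟩ := hne
    obtain ⟨j, hj, ⟨w⟩⟩ := h i
    have : ∀ a b, (S.diagram.induce K).Walk a b → a ∈ Z → b ∈ Z := by
      intro a b w
      induction w with
      | nil => exact id
      | cons hadj _ ih =>
        rename_i u v _ _
        intro hu
        apply ih
        by_contra hv
        have := (hcon u hu).2 v hv
        exact hadj.2.1 (by exact_mod_cast this)
    exact hj (hcon j (this i j w hi)).1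

/-- Affine parametrization of `μ - span K`. -/
def par (μ : V) (K : Set (Fin m)) [Fintype K] : (K → ℝ) →ᵃ[ℝ] V :=
  AffineMap.const ℝ _ μ - (Fintype.linearCombination ℝ (fun i : K => S.root i)).toAffineMap

lemma par_apply (μ : V) (K : Set (Fin m)) [Fintype K] (γ : K → ℝ) :
    S.par μ K γ = μ - ∑ i, γ i • S.root i := by
  simp [par, Fintype.linearCombination_apply]

lemma par_embedding (μ : V) (K : Set (Fin m)) [Fintype K] : IsEmbedding (S.par μ K) := by
  have hinj : Function.Injective (Fintype.linearCombination ℝ (fun i : K => S.root i)) :=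
    (S.root_indep.comp _ Subtype.val_injective).fintypeLinearCombination_injective
  have h1 : IsEmbedding (Fintype.linearCombination ℝ (fun i : K => S.root i)) :=
    (LinearMap.isClosedEmbedding_of_injective (LinearMap.ker_eq_bot.2 hinj)).isEmbedding
  exact (Homeomorph.subLeft μ).isEmbedding.comp h1

lemma coroot_par (μ : V) (K : Set (Fin m)) [Fintype K] (γ : K → ℝ) (i : K) :
    S.coroot i (S.par μ K γ) =
      PP (fun i j : K => (S.A i j : ℝ)) (fun i : K => S.coroot i μ) γ i := by
  rw [par_apply, PP, map_sub, map_sum]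
  simp [S.pairing, mul_comm]

lemma s_face (μ : V) (K : Set (Fin m)) {i : Fin m} (hi : i ∈ K) {x : V} (hx : x ∈ S.face μ K) :
    S.s i x ∈ S.face μ K := by
  have h : (S.s i : V →ₗ[ℝ] V) '' S.face μ K ⊆ S.face μ K := by
    rw [face, LinearMap.image_convexHull]
    apply convexHull_mono
    rintro _ ⟨_, ⟨w, hw, rfl⟩, rfl⟩
    exact ⟨S.s i * w, (S.WI K).mul_mem (Subgroup.subset_closure ⟨i, hi, rfl⟩) hw, rfl⟩
  exact h ⟨x, hx, rfl⟩

lemma mem_face_self (μ : V) (K : Set (Fin m)) : μ ∈ S.face μ K :=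
  subset_convexHull _ _ ⟨1, (S.WI K).one_mem, rfl⟩

lemma face_mono (μ : V) {K I : Set (Fin m)} (h : K ⊆ I) : S.face μ K ⊆ S.face μ I :=
  convexHull_mono (image_mono (Subgroup.closure_mono (image_mono h)))

lemma stab (μ : V) (K : Set (Fin m)) [Fintype K] [DecidableEq K] :
    Stab (fun i j : K => (S.A i j : ℝ)) (fun i : K => S.coroot i μ)
      (S.par μ K ⁻¹' S.face μ K) where
  cvx := (convex_convexHull ℝ _).affine_preimage _
  zero := by
    have : S.par μ K 0 = μ := by simp [par_apply]
    rw [mem_preimage, this]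
    exact S.mem_face_self μ K
  refl i γ hγ := by
    have h := S.s_face μ K i.2 hγ
    rw [s_apply', coroot_par] at h
    rw [mem_preimage]
    convert h using 1
    generalize PP _ _ γ i = t
    rw [par_apply, par_apply, sub_sub]
    congr 1
    simp only [Pi.add_apply, Pi.smul_apply, add_smul, Finset.sum_add_distrib]
    congr 1
    rw [Finset.sum_eq_single i]
    · simp
    · intro b _ hb; simp [Pi.single_eq_of_ne hb]
    · simp

lemma face_eq_image (μ : V) (hμ : μ ∈ S.chamber) (K : Set (Fin m)) [Fintype K] :
    S.par μ K '' (S.par μ K ⁻¹' S.face μ K) = S.face μ K := by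
  rw [image_preimage_eq_iff]
  intro x hx
  obtain ⟨c, -, hc, -, rfl⟩ := S.face_subset μ hμ K hx
  exact ⟨fun i => c i, by rw [par_apply, S.sum_ext K c hc]⟩

lemma root_inj {c d : Fin m → ℝ} (h : ∑ i, c i • S.root i = ∑ i, d i • S.root i) : c = d :=
  S.root_indep.fintypeLinearCombination_injective
    (by simpa [Fintype.linearCombination_apply] using h)

lemma interior_pos {ι : Type*} [Fintype ι] [DecidableEq ι] {D : Set (ι → ℝ)}
    (hD : ∀ γ ∈ D, ∀ i, 0 ≤ γ i) {γ : ι → ℝ} (hγ : γ ∈ interior D) (i : ι) : 0 < γ i := by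
  have hsub : D ⊆ (fun γ : ι → ℝ => γ i) ⁻¹' Ici 0 := fun γ h => hD γ h i
  have h := interior_mono hsub hγ
  rw [← (isOpenMap_eval i).preimage_interior_eq_interior_preimage (continuous_apply i),
    interior_Ici] at h
  exact h

lemma ri_eq {μ : V} (hμ : μ ∈ S.chamber) {K : Set (Fin m)} (hK : S.MuConnected μ K) :
    intrinsicInterior ℝ (S.face μ K) ∩ S.chamber =
        ((fun v => μ - v) '' S.conePos K) ∩ S.chamber := by
  classical
  have hintr := (S.good hμ hK).interior_nonempty (S.stab μ K)
  have hri : intrinsicInterior ℝ (S.face μ K) =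
      S.par μ K '' interior (S.par μ K ⁻¹' S.face μ K) := by
    rw [← intrinsicInterior_image_of_inj _ (S.par_embedding μ K) hintr, S.face_eq_image μ hμ]
  rw [hri]
  ext x
  refine and_congr_left fun hx => ?_
  constructor
  · rintro ⟨γ, hγ, rfl⟩
    obtain ⟨c, hc0, hc, -, he⟩ := S.face_subset μ hμ K (interior_subset hγ : _ ∈ _)
    refine ⟨_, ⟨c, ?_, hc, rfl⟩, he.symm⟩
    have key : ∀ γ' ∈ S.par μ K ⁻¹' S.face μ K, ∀ i, 0 ≤ γ' i := by
      intro γ' hγ' i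
      obtain ⟨c, hc0, hc, -, he⟩ := S.face_subset μ hμ K hγ'
      have : γ' = fun i : K => c i := by
        apply (S.par_embedding μ K).injective
        rw [he, par_apply, S.sum_ext K c hc]
      rw [this]; exact hc0 i
    have : γ = fun i : K => c i := by
      apply (S.par_embedding μ K).injective
      rw [he, par_apply, S.sum_ext K c hc]
    intro i hi
    have h := interior_pos key hγ ⟨i, hi⟩
    rwa [this] at h
  · rintro ⟨_, ⟨c, hc0, hc, rfl⟩, rfl⟩
    have he : S.par μ K (fun i => c i) = μ - ∑ i, c i • S.root i := by
      rw [par_apply, S.sum_ext K c hc]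
    refine ⟨fun i => c i, (S.good hμ hK).mem_interior (S.stab μ K) (fun i => hc0 i i.2) ?_, he⟩
    intro i
    rw [← coroot_par, he]
    exact hx i

lemma cone_disj (μ : V) {K K' : Set (Fin m)} (h : K ≠ K') :
    Disjoint (((fun v => μ - v) '' S.conePos K) ∩ S.chamber)
        (((fun v => μ - v) '' S.conePos K') ∩ S.chamber) := by
  rw [Set.disjoint_left]
  rintro _ ⟨⟨_, ⟨c, hc, hc0, rfl⟩, rfl⟩, -⟩ ⟨⟨_, ⟨d, hd, hd0, rfl⟩, he⟩, -⟩
  have := S.root_inj (sub_right_injective he)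
  subst this
  apply h
  ext i
  constructor
  · intro hi
    by_contra h'
    exact (hc i hi).ne' (hd0 i h')
  · intro hi
    by_contra h'
    exact (hd i hi).ne' (hc0 i h')

end GCMRealization
end

open GCMRealization in
theorem statement_8 {m : ℕ} {V : Type*} [NormedAddCommGroup V] [NormedSpace ℝ V]
    (S : GCMRealization m V) (μ : V) (hμ : μ ∈ S.chamber)
    (I : Set (Fin m)) (hcon : S.MuConnected μ I) :
    (S.face μ I ∩ S.chamber =
      ⋃ K ∈ {K : Set (Fin m) | K ⊆ I ∧ S.MuConnected μ K},
        intrinsicInterior ℝ (S.face μ K) ∩ S.chamber) ∧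
    (S.face μ I ∩ S.chamber =
      ⋃ K ∈ {K : Set (Fin m) | K ⊆ I ∧ S.MuConnected μ K},
        ((fun v => μ - v) '' S.conePos K) ∩ S.chamber) ∧
    (∀ K K' : Set (Fin m), K ⊆ I → S.MuConnected μ K → K' ⊆ I → S.MuConnected μ K' →
      K ≠ K' → Disjoint (intrinsicInterior ℝ (S.face μ K) ∩ S.chamber)
        (intrinsicInterior ℝ (S.face μ K') ∩ S.chamber)) ∧
    (∀ K K' : Set (Fin m), K ⊆ I → S.MuConnected μ K → K' ⊆ I → S.MuConnected μ K' →
      K ≠ K' → Disjoint (((fun v => μ - v) '' S.conePos K) ∩ S.chamber)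
        (((fun v => μ - v) '' S.conePos K') ∩ S.chamber)) ∧
    (∀ K : Set (Fin m), K ⊆ I → S.MuConnected μ K →
      intrinsicInterior ℝ (S.face μ K) ∩ S.chamber =
        ((fun v => μ - v) '' S.conePos K) ∩ S.chamber) := by

  have hri : ∀ K : Set (Fin m), S.MuConnected μ K →
      intrinsicInterior ℝ (S.face μ K) ∩ S.chamber =
        ((fun v => μ - v) '' S.conePos K) ∩ S.chamber := fun K hK => S.ri_eq hμ hK
  have hunion : S.face μ I ∩ S.chamber =
      ⋃ K ∈ {K : Set (Fin m) | K ⊆ I ∧ S.MuConnected μ K},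
        intrinsicInterior ℝ (S.face μ K) ∩ S.chamber := by
    apply Subset.antisymm
    · rintro x ⟨hx, hxC⟩
      obtain ⟨c, hc0, hcI, hH, rfl⟩ := S.face_subset μ hμ I hx
      have hK := S.muConnected_of_HC hH
      simp only [mem_iUnion]
      refine ⟨{i | c i ≠ 0}, ⟨fun i hi => ?_, hK⟩, ?_⟩
      · by_contra h
        exact hi (hcI i h)
      · rw [hri _ hK]
        refine ⟨⟨_, ⟨c, fun i hi => lt_of_le_of_ne (hc0 i) (Ne.symm hi), ?_, rfl⟩, rfl⟩, hxC⟩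
        intro i hi
        simpa using hi
    · refine iUnion₂_subset fun K hK => inter_subset_inter_left _ ?_
      exact intrinsicInterior_subset.trans (S.face_mono μ hK.1)
  refine ⟨hunion, ?_, ?_, ?_, fun K _ hK => hri K hK⟩
  · rw [hunion]
    exact iUnion₂_congr fun K hK => hri K hK.2
  · intro K K' _ hK _ hK' hne
    rw [hri K hK, hri K' hK']
    exact S.cone_disj μ hne
  · intro K K' _ _ _ _ hne
    exact S.cone_disj μ hne
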